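/- Let D = (E, 𝓕) be a set system, let a₁, b₁, …, aₙ, bₙ ∈ E with aᵢ ≠ bᵢ for each i, and let e ∈ E with e ∉ {aᵢ, bᵢ} for all i. If the iterated handle slide (⋯((D_{a₁b₁})_{a₂b₂})⋯)_{aₙbₙ} is a delta-matroid, then (⋯(((D − e)_{a₁b₁})_{a₂b₂})⋯)_{aₙbₙ} and (⋯(((D/e)_{a₁b₁})_{a₂b₂})⋯)_{aₙbₙ} are also delta-matroids (provided their collections of feasible sets are nonempty). -/

import Mathlib

/-- A set system: a finite ground set `E` together with a collection `F`
of finite subsets (intended to be subsets of `E`). -/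
structure SetSystem (α : Type*) where
  E : Finset α
  F : Set (Finset α)

namespace SetSystem

variable {α : Type*} [DecidableEq α]

/-- A delta-matroid: a set system with nonempty feasible collection, all feasible
sets contained in the ground set, satisfying the symmetric exchange axiom. -/
def IsDeltaMatroid (D : SetSystem α) : Prop :=
  D.F.Nonempty ∧ (∀ F ∈ D.F, F ⊆ D.E) ∧
    ∀ F₁ ∈ D.F, ∀ F₂ ∈ D.F, ∀ x ∈ symmDiff F₁ F₂,
      ∃ y ∈ symmDiff F₁ F₂, symmDiff F₁ {x, y} ∈ D.F

/-- The handle slide taking `a` over `b`: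
`𝓕_{ab} = 𝓕 Δ {X ∪ {a} : X ⊆ E − {a,b}, X ∪ {b} ∈ 𝓕}`. -/
def slide (D : SetSystem α) (a b : α) : SetSystem α :=
  ⟨D.E, symmDiff D.F
    {Y : Finset α | ∃ X : Finset α, X ⊆ D.E \ {a, b} ∧ X ∪ {b} ∈ D.F ∧ Y = X ∪ {a}}⟩

/-- Iterated handle slides along a list of pairs. -/
def slides (D : SetSystem α) : List (α × α) → SetSystem α
  | [] => D
  | (a, b) :: L => slides (D.slide a b) L

/-- The twist `D ⋆ A = (E, {A Δ X : X ∈ 𝓕})`. -/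
def twist (D : SetSystem α) (A : Finset α) : SetSystem α :=
  ⟨D.E, {Y : Finset α | ∃ X ∈ D.F, Y = symmDiff A X}⟩

/-- Deletion of `e`: `D − e = (E − e, {F : F ⊆ E − e, F ∈ 𝓕})`. -/
def del (D : SetSystem α) (e : α) : SetSystem α :=
  ⟨D.E.erase e, {F : Finset α | F ⊆ D.E.erase e ∧ F ∈ D.F}⟩

/-- Contraction of `e`: `D/e = (E − e, {F : F ⊆ E − e, F ∪ {e} ∈ 𝓕})`. -/
def contr (D : SetSystem α) (e : α) : SetSystem α :=
  ⟨D.E.erase e, {F : Finset α | F ⊆ D.E.erase e ∧ F ∪ {e} ∈ D.F}⟩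

/-- The set system `D(A)` of a symmetric binary matrix `A` indexed by `E`:
feasible sets are the `W ⊆ E` whose principal submatrix `A[W]` is invertible
(the empty submatrix being invertible by convention). -/
def ofMatrix (E : Finset α) (A : Matrix E E (ZMod 2)) : SetSystem α :=
  ⟨E, {W : Finset α | ∃ h : ∀ x ∈ W, x ∈ E,
        IsUnit (Matrix.submatrix A
          (fun i : W => (⟨i.1, h i.1 i.2⟩ : E)) (fun i : W => (⟨i.1, h i.1 i.2⟩ : E)))}⟩

/-- `D` is binary: `D = D(A) ⋆ F` for some feasible `F ∈ 𝓕` and some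
symmetric matrix `A` over GF(2) indexed by the ground set. -/
def IsBinary (D : SetSystem α) : Prop :=
  ∃ F ∈ D.F, ∃ A : Matrix D.E D.E (ZMod 2),
    A.IsSymm ∧ D = (ofMatrix D.E A).twist F

/-- `IsMinor D T`: `T` is obtained from `D` by a sequence of deletions and
contractions (keeping feasible collections nonempty). -/
inductive IsMinor : SetSystem α → SetSystem α → Prop
  | refl (D : SetSystem α) : IsMinor D D
  | del {D T : SetSystem α} (e : α) (he : e ∈ D.E) (hne : (D.del e).F.Nonempty)
      (h : IsMinor (D.del e) T) : IsMinor D T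
  | contr {D T : SetSystem α} (e : α) (he : e ∈ D.E) (hne : (D.contr e).F.Nonempty)
      (h : IsMinor (D.contr e) T) : IsMinor D T

/-- Isomorphism of set systems: a bijection of ground sets carrying one
feasible collection onto the other. -/
def Isomorphic {β : Type*} [DecidableEq β] (D : SetSystem α) (D' : SetSystem β) : Prop :=
  ∃ φ : α → β, Set.InjOn φ D.E ∧ D.E.image φ = D'.E ∧
    D'.F = {Y : Finset β | ∃ X ∈ D.F, Y = X.image φ}

end SetSystem

open SetSystem

/-- The minimal non-binary delta-matroids of Bouchet–Duchamp. -/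
def S₁ : SetSystem ℕ := ⟨{1, 2, 3}, {∅, {1, 2}, {1, 3}, {2, 3}, {1, 2, 3}}⟩
def S₂ : SetSystem ℕ := ⟨{1, 2, 3}, {∅, {1}, {2}, {3}, {1, 2}, {1, 3}, {2, 3}}⟩
def S₃ : SetSystem ℕ := ⟨{1, 2, 3}, {∅, {2}, {3}, {1, 2}, {1, 3}, {1, 2, 3}}⟩
def S₄ : SetSystem ℕ := ⟨{1, 2, 3, 4}, {∅, {1, 2}, {1, 3}, {1, 4}, {2, 3}, {2, 4}, {3, 4}}⟩
def S₅ : SetSystem ℕ := ⟨{1, 2, 3, 4}, {∅, {1, 2}, {1, 4}, {2, 3}, {3, 4}, {1, 2, 3, 4}}⟩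

namespace SetSystem

theorem mem_slide_iff {α : Type*} [DecidableEq α] {D : SetSystem α} {a b : α}
    (ha : a ∈ D.E) (hab : a ≠ b) (Y : Finset α) :
    Y ∈ (D.slide a b).F ↔
      Xor (Y ∈ D.F) (a ∈ Y ∧ b ∉ Y ∧ Y ⊆ D.E ∧ insert b (Y.erase a) ∈ D.F) := by
  have key : (∃ X : Finset α, X ⊆ D.E \ {a, b} ∧ X ∪ {b} ∈ D.F ∧ Y = X ∪ {a}) ↔
      (a ∈ Y ∧ b ∉ Y ∧ Y ⊆ D.E ∧ insert b (Y.erase a) ∈ D.F) := by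
    constructor
    · rintro ⟨X, hX, hF, rfl⟩
      have h : insert b ((X ∪ {a}).erase a) = X ∪ {b} := by grind
      rw [h]
      refine ⟨?_, ?_, ?_, hF⟩ <;> grind
    · rintro ⟨haY, hbY, hYE, hF⟩
      have h : Y.erase a ∪ {b} = insert b (Y.erase a) := by grind
      refine ⟨Y.erase a, ?_, h ▸ hF, ?_⟩ <;> grind
  rw [← key]
  rfl

theorem slide_del {α : Type*} [DecidableEq α] {D : SetSystem α} {a b e : α}
    (ha : a ∈ D.E) (hb : b ∈ D.E) (hab : a ≠ b) (hea : e ≠ a) (heb : e ≠ b) :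
    (D.del e).slide a b = (D.slide a b).del e := by
  have hF : ((D.del e).slide a b).F = ((D.slide a b).del e).F := by
    ext Y
    rw [mem_slide_iff (D := D.del e) (Finset.mem_erase.2 ⟨hea.symm, ha⟩) hab]
    change _ ↔ Y ⊆ D.E.erase e ∧ Y ∈ (D.slide a b).F
    rw [mem_slide_iff ha hab]
    change Xor (Y ⊆ D.E.erase e ∧ Y ∈ D.F)
      (a ∈ Y ∧ b ∉ Y ∧ Y ⊆ D.E.erase e ∧
        insert b (Y.erase a) ⊆ D.E.erase e ∧ insert b (Y.erase a) ∈ D.F) ↔ _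
    have h₁ : Y ⊆ D.E.erase e → Y ⊆ D.E := by grind
    have h₂ : Y ⊆ D.E.erase e → insert b (Y.erase a) ⊆ D.E.erase e := by grind
    unfold Xor
    tauto
  exact congrArg (SetSystem.mk (D.E.erase e)) hF

theorem slide_contr {α : Type*} [DecidableEq α] {D : SetSystem α} {a b e : α} (he : e ∈ D.E)
    (ha : a ∈ D.E) (hb : b ∈ D.E) (hab : a ≠ b) (hea : e ≠ a) (heb : e ≠ b) :
    (D.contr e).slide a b = (D.slide a b).contr e := by
  have hF : ((D.contr e).slide a b).F = ((D.slide a b).contr e).F := by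
    ext Y
    rw [mem_slide_iff (D := D.contr e) (Finset.mem_erase.2 ⟨hea.symm, ha⟩) hab]
    change _ ↔ Y ⊆ D.E.erase e ∧ Y ∪ {e} ∈ (D.slide a b).F
    rw [mem_slide_iff ha hab]
    change Xor (Y ⊆ D.E.erase e ∧ Y ∪ {e} ∈ D.F)
      (a ∈ Y ∧ b ∉ Y ∧ Y ⊆ D.E.erase e ∧
        insert b (Y.erase a) ⊆ D.E.erase e ∧ insert b (Y.erase a) ∪ {e} ∈ D.F) ↔ _
    have h₁ : Y ⊆ D.E.erase e → Y ∪ {e} ⊆ D.E := by grind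
    have h₂ : Y ⊆ D.E.erase e → insert b (Y.erase a) ⊆ D.E.erase e := by grind
    have h₃ : insert b ((Y ∪ {e}).erase a) = insert b (Y.erase a) ∪ {e} := by grind
    have h₄ : a ∈ Y ∪ {e} ↔ a ∈ Y := by grind
    have h₅ : b ∈ Y ∪ {e} ↔ b ∈ Y := by grind
    rw [h₃, h₄, h₅]
    unfold Xor
    tauto
  exact congrArg (SetSystem.mk (D.E.erase e)) hF

theorem slides_del {α : Type*} [DecidableEq α] {e : α} (L : List (α × α)) (D : SetSystem α)
    (hL : ∀ p ∈ L, p.1 ∈ D.E ∧ p.2 ∈ D.E ∧ p.1 ≠ p.2 ∧ e ≠ p.1 ∧ e ≠ p.2) :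
    (D.del e).slides L = (D.slides L).del e := by
  induction L generalizing D with
  | nil => rfl
  | cons p L ih =>
    obtain ⟨ha, hb, hab, hea, heb⟩ := hL p List.mem_cons_self
    change ((D.del e).slide p.1 p.2).slides L = ((D.slide p.1 p.2).slides L).del e
    rw [slide_del ha hb hab hea heb]
    exact ih (D.slide p.1 p.2) fun q hq => hL q (List.mem_cons_of_mem p hq)

theorem slides_contr {α : Type*} [DecidableEq α] {e : α} (L : List (α × α)) (D : SetSystem α)
    (he : e ∈ D.E)
    (hL : ∀ p ∈ L, p.1 ∈ D.E ∧ p.2 ∈ D.E ∧ p.1 ≠ p.2 ∧ e ≠ p.1 ∧ e ≠ p.2) :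
    (D.contr e).slides L = (D.slides L).contr e := by
  induction L generalizing D with
  | nil => rfl
  | cons p L ih =>
    obtain ⟨ha, hb, hab, hea, heb⟩ := hL p List.mem_cons_self
    change ((D.contr e).slide p.1 p.2).slides L = ((D.slide p.1 p.2).slides L).contr e
    rw [slide_contr he ha hb hab hea heb]
    exact ih (D.slide p.1 p.2) he fun q hq => hL q (List.mem_cons_of_mem p hq)

theorem IsDeltaMatroid.del {α : Type*} [DecidableEq α] {D : SetSystem α} (h : D.IsDeltaMatroid)
    {e : α} (hne : (D.del e).F.Nonempty) : (D.del e).IsDeltaMatroid := by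
  refine ⟨hne, fun F hF => hF.1, ?_⟩
  rintro F₁ ⟨hF₁, h₁⟩ F₂ ⟨hF₂, h₂⟩ x hx
  obtain ⟨y, hy, hxy⟩ := h.2.2 F₁ h₁ F₂ h₂ x hx
  refine ⟨y, hy, ?_, hxy⟩
  rw [Finset.mem_symmDiff] at hx hy
  intro z hz
  rw [Finset.mem_symmDiff] at hz
  grind

theorem IsDeltaMatroid.contr {α : Type*} [DecidableEq α] {D : SetSystem α}
    (h : D.IsDeltaMatroid) {e : α} (hne : (D.contr e).F.Nonempty) :
    (D.contr e).IsDeltaMatroid := by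
  refine ⟨hne, fun F hF => hF.1, ?_⟩
  rintro F₁ ⟨hF₁, h₁⟩ F₂ ⟨hF₂, h₂⟩ x hx
  have hS : symmDiff (F₁ ∪ {e}) (F₂ ∪ {e}) = symmDiff F₁ F₂ := by
    ext z
    simp only [Finset.mem_symmDiff]
    grind
  obtain ⟨y, hy, hxy⟩ := h.2.2 _ h₁ _ h₂ x (hS ▸ hx)
  rw [hS] at hy
  refine ⟨y, hy, ?_, ?_⟩
  · rw [Finset.mem_symmDiff] at hx hy
    intro z hz
    rw [Finset.mem_symmDiff] at hz
    grind
  · convert hxy using 1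
    rw [Finset.mem_symmDiff] at hx hy
    ext z
    simp only [Finset.mem_symmDiff, Finset.mem_union]
    grind

end SetSystem

/-- if an iterated handle slide of `D` is a delta-matroid, then the
same iterated handle slides applied to `D − e` and `D/e` (for `e` not involved in
the slides) are delta-matroids, provided their feasible collections are nonempty. -/
theorem stmt_4 {α : Type*} [DecidableEq α] (D : SetSystem α)
    (hD : D.F.Nonempty ∧ ∀ F ∈ D.F, F ⊆ D.E)
    (L : List (α × α)) (e : α) (he : e ∈ D.E)
    (hL : ∀ p ∈ L, p.1 ∈ D.E ∧ p.2 ∈ D.E ∧ p.1 ≠ p.2 ∧ e ≠ p.1 ∧ e ≠ p.2)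
    (h : (D.slides L).IsDeltaMatroid) :
    (((D.del e).slides L).F.Nonempty → ((D.del e).slides L).IsDeltaMatroid) ∧
    (((D.contr e).slides L).F.Nonempty → ((D.contr e).slides L).IsDeltaMatroid) := by
  rw [slides_del L D hL, slides_contr L D he hL]
  exact ⟨h.del, h.contr⟩
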